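/- Let F : ℝ³ → ℝ be a function whose horizontal derivatives X₁F and X₂F exist and are continuous (F ∈ Γ¹(ℍ)), and let x = (x₁,x₂,x₃) : [0,T] → ℝ³ be a horizontal curve. Then for almost every s ∈ (0,T), the map s ↦ F(x(s)) is differentiable at s with derivative d F(x(s))/ds = (ẋ₁(s), ẋ₂(s)) · ∇_H F(x(s)). -/

import Mathlib

open MeasureTheory Set

noncomputable section

/-- Heisenberg group law on ℝ³. -/
def hMul (a b : ℝ × ℝ × ℝ) : ℝ × ℝ × ℝ :=
  (a.1 + b.1, a.2.1 + b.2.1, a.2.2 + b.2.2 + (a.1 * b.2.1 - b.1 * a.2.1) / 2)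

/-- Korányi gauge. -/
def gaugeH (a : ℝ × ℝ × ℝ) : ℝ :=
  ((a.1 ^ 2 + a.2.1 ^ 2) ^ 2 + a.2.2 ^ 2) ^ ((1 : ℝ) / 4)

/-- Korányi distance `d_G(x,x') = ‖(x')⁻¹ ∘ x‖_G` (the inverse is `-x'`). -/
def dG (a b : ℝ × ℝ × ℝ) : ℝ := gaugeH (hMul (-b) a)

/-- Euclidean norm on ℝ². -/
def norm2 (v : ℝ × ℝ) : ℝ := Real.sqrt (v.1 ^ 2 + v.2 ^ 2)

/-- Euclidean dot product on ℝ². -/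
def dot2 (v w : ℝ × ℝ) : ℝ := v.1 * w.1 + v.2 * w.2

/-- Euclidean norm on ℝ³. -/
def norm3 (v : ℝ × ℝ × ℝ) : ℝ := Real.sqrt (v.1 ^ 2 + v.2.1 ^ 2 + v.2.2 ^ 2)

/-- The horizontal dynamics `f^ℍ(x,z) = (z₁, z₂, (z₂x₁ - z₁x₂)/2)`. -/
def fH (x : ℝ × ℝ × ℝ) (z : ℝ × ℝ) : ℝ × ℝ × ℝ :=
  (z.1, z.2, (z.2 * x.1 - z.1 * x.2.1) / 2)

/-- `x` is the horizontal curve on `[a,b]` with horizontal velocity `z` and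
initial point `ξ`, i.e. `x(t) = ξ + ∫_a^t f^ℍ(x(s), z(s)) ds`. -/
def IsHorizontalCurveOn (a b : ℝ) (z : ℝ → ℝ × ℝ) (ξ : ℝ × ℝ × ℝ)
    (x : ℝ → ℝ × ℝ × ℝ) : Prop :=
  ∀ t ∈ Set.Icc a b, x t = ξ + ∫ s in a..t, fH (x s) (z s)

/-- The horizontal derivative `X₁F(x) = ∂_{x₁}F - (x₂/2)∂_{x₃}F`, as a line derivative
along the horizontal direction `(1, 0, -x₂/2)`. -/
def X1d (F : ℝ × ℝ × ℝ → ℝ) (x : ℝ × ℝ × ℝ) : ℝ :=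
  deriv (fun s : ℝ => F (x.1 + s, x.2.1, x.2.2 - s * x.2.1 / 2)) 0

/-- The horizontal derivative `X₂F(x) = ∂_{x₂}F + (x₁/2)∂_{x₃}F`, as a line derivative
along the horizontal direction `(0, 1, x₁/2)`. -/
def X2d (F : ℝ × ℝ × ℝ → ℝ) (x : ℝ × ℝ × ℝ) : ℝ :=
  deriv (fun s : ℝ => F (x.1, x.2.1 + s, x.2.2 + s * x.1 / 2)) 0

/-- `F ∈ Γ¹(ℍ)`: the horizontal derivatives `X₁F`, `X₂F` exist and are continuous. -/
def Gamma1 (F : ℝ × ℝ × ℝ → ℝ) : Prop :=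
  (∀ x : ℝ × ℝ × ℝ,
      DifferentiableAt ℝ (fun s : ℝ => F (x.1 + s, x.2.1, x.2.2 - s * x.2.1 / 2)) 0 ∧
      DifferentiableAt ℝ (fun s : ℝ => F (x.1, x.2.1 + s, x.2.2 + s * x.1 / 2)) 0) ∧
  Continuous (X1d F) ∧ Continuous (X2d F)

open Filter Topology Asymptotics

/-- The flow of the horizontal field `X₁` for time `a`. -/
def flowX1 (q : ℝ × ℝ × ℝ) (a : ℝ) : ℝ × ℝ × ℝ := (q.1 + a, q.2.1, q.2.2 - a * q.2.1 / 2)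

/-- The flow of the horizontal field `X₂` for time `a`. -/
def flowX2 (q : ℝ × ℝ × ℝ) (a : ℝ) : ℝ × ℝ × ℝ := (q.1, q.2.1 + a, q.2.2 + a * q.1 / 2)

lemma continuous_flowX1 : Continuous fun p : (ℝ × ℝ × ℝ) × ℝ => flowX1 p.1 p.2 := by
  unfold flowX1; fun_prop

lemma continuous_flowX2 : Continuous fun p : (ℝ × ℝ × ℝ) × ℝ => flowX2 p.1 p.2 := by
  unfold flowX2; fun_prop

lemma flowX1_zero (q : ℝ × ℝ × ℝ) : flowX1 q 0 = q := by simp [flowX1]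

lemma flowX2_zero (q : ℝ × ℝ × ℝ) : flowX2 q 0 = q := by simp [flowX2]

lemma flowX1_flowX1 (q : ℝ × ℝ × ℝ) (a b : ℝ) : flowX1 (flowX1 q a) b = flowX1 q (a + b) := by
  simp only [flowX1, Prod.mk.injEq]
  refine ⟨by ring, trivial, by ring⟩

lemma flowX2_flowX2 (q : ℝ × ℝ × ℝ) (a b : ℝ) : flowX2 (flowX2 q a) b = flowX2 q (a + b) := by
  simp only [flowX2, Prod.mk.injEq, true_and]
  refine ⟨by ring, by ring⟩

/-- Moving along `X₁`, then `X₂`, then around a commutator loop of area `u * v`. -/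
lemma flow_commutator (q : ℝ × ℝ × ℝ) (a b u v : ℝ) :
    flowX2 (flowX1 (flowX2 (flowX1 (flowX2 (flowX1 q a) b) u) v) (-u)) (-v) =
      (q.1 + a, q.2.1 + b, q.2.2 + (q.1 * b - q.2.1 * a) / 2 + a * b / 2 + u * v) := by
  simp only [flowX1, flowX2, Prod.mk.injEq]
  refine ⟨by ring, by ring, by ring⟩

lemma Gamma1.hasDerivAt_flowX1 {F : ℝ × ℝ × ℝ → ℝ} (hF : Gamma1 F) (q : ℝ × ℝ × ℝ) (a : ℝ) :
    HasDerivAt (fun s => F (flowX1 q s)) (X1d F (flowX1 q a)) a := by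
  have h : HasDerivAt (fun s => F (flowX1 (flowX1 q a) s)) (X1d F (flowX1 q a)) (a - a) := by
    rw [sub_self]; exact (hF.1 (flowX1 q a)).1.hasDerivAt
  simpa only [flowX1_flowX1, add_sub_cancel] using h.comp_sub_const a a

lemma Gamma1.hasDerivAt_flowX2 {F : ℝ × ℝ × ℝ → ℝ} (hF : Gamma1 F) (q : ℝ × ℝ × ℝ) (a : ℝ) :
    HasDerivAt (fun s => F (flowX2 q s)) (X2d F (flowX2 q a)) a := by
  have h : HasDerivAt (fun s => F (flowX2 (flowX2 q a) s)) (X2d F (flowX2 q a)) (a - a) := by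
    rw [sub_self]; exact (hF.1 (flowX2 q a)).2.hasDerivAt
  simpa only [flowX2_flowX2, add_sub_cancel] using h.comp_sub_const a a

/-- Mean value theorem on a segment from `0`, degenerate case included. -/
lemma exists_sub_eq_mul_of_hasDerivAt {g g' : ℝ → ℝ} (hg : ∀ s, HasDerivAt g (g' s) s) (a : ℝ) :
    ∃ θ, |θ| ≤ |a| ∧ g a - g 0 = a * g' θ := by
  rcases lt_trichotomy a 0 with ha | rfl | ha
  · obtain ⟨c, hc, h⟩ := exists_hasDerivAt_eq_slope g g' ha
      (fun s _ => (hg s).continuousAt.continuousWithinAt) (fun s _ => hg s)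
    refine ⟨c, ?_, ?_⟩
    · rw [abs_of_neg hc.2, abs_of_neg ha]; linarith [hc.1]
    · rw [h]; field_simp; ring
  · exact ⟨0, le_rfl, by simp⟩
  · obtain ⟨c, hc, h⟩ := exists_hasDerivAt_eq_slope g g' ha
      (fun s _ => (hg s).continuousAt.continuousWithinAt) (fun s _ => hg s)
    refine ⟨c, ?_, ?_⟩
    · rw [abs_of_pos hc.1, abs_of_pos ha]; exact hc.2.le
    · rw [h]; field_simp; ring

/-- First-order expansion along a flow whose derivative is continuous, uniformly in the
base point. -/
lemma isLittleO_flow {ι : Type*} {l : Filter ι} {F D : ℝ × ℝ × ℝ → ℝ}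
    {Φ : ℝ × ℝ × ℝ → ℝ → ℝ × ℝ × ℝ} (hΦ : Continuous fun p : (ℝ × ℝ × ℝ) × ℝ => Φ p.1 p.2)
    (hΦ0 : ∀ q, Φ q 0 = q) (hD : Continuous D)
    (hder : ∀ q s, HasDerivAt (fun s => F (Φ q s)) (D (Φ q s)) s)
    {p : ℝ × ℝ × ℝ} {q : ι → ℝ × ℝ × ℝ} {a : ι → ℝ}
    (hq : Tendsto q l (𝓝 p)) (ha : Tendsto a l (𝓝 0)) :
    (fun i => F (Φ (q i) (a i)) - F (q i) - a i * D p) =o[l] a := by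
  choose θ hθ hmv using fun i => exists_sub_eq_mul_of_hasDerivAt (hder (q i)) (a i)
  have hθ0 : Tendsto θ l (𝓝 0) :=
    squeeze_zero_norm hθ (by simpa using ha.abs)
  have hlim : Tendsto (fun i => D (Φ (q i) (θ i)) - D p) l (𝓝 0) := by
    have := ((hD.comp hΦ).tendsto (p, 0)).comp (hq.prodMk_nhds hθ0)
    simpa [Function.comp_def, hΦ0] using this.sub_const (D p)
  have h := (isBigO_refl a l).mul_isLittleO ((isLittleO_one_iff ℝ).2 hlim)
  simp only [mul_one] at h
  refine h.congr_left fun i => ?_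
  have := hmv i
  rw [hΦ0] at this
  rw [this]; ring

lemma tendsto_flow {ι : Type*} {l : Filter ι}
    {Φ : ℝ × ℝ × ℝ → ℝ → ℝ × ℝ × ℝ} (hΦ : Continuous fun p : (ℝ × ℝ × ℝ) × ℝ => Φ p.1 p.2)
    (hΦ0 : ∀ q, Φ q 0 = q)
    {p : ℝ × ℝ × ℝ} {q : ι → ℝ × ℝ × ℝ} {a : ι → ℝ}
    (hq : Tendsto q l (𝓝 p)) (ha : Tendsto a l (𝓝 0)) :
    Tendsto (fun i => Φ (q i) (a i)) l (𝓝 p) := by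
  simpa [Function.comp_def, hΦ0] using (hΦ.tendsto (p, 0)).comp (hq.prodMk_nhds ha)

lemma isBigO_sqrt_abs {l : Filter ℝ} {c h : ℝ → ℝ} (hc : c =O[l] fun r => h r ^ 2) :
    (fun r => √|c r|) =O[l] h := by
  obtain ⟨C, hC⟩ := hc.bound
  refine IsBigO.of_bound (√|C|) ?_
  filter_upwards [hC] with r hr
  rw [Real.norm_eq_abs, abs_of_nonneg (Real.sqrt_nonneg _), Real.norm_eq_abs,
    ← Real.sqrt_sq_eq_abs (h r), ← Real.sqrt_mul (abs_nonneg _)]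
  refine Real.sqrt_le_sqrt ?_
  rw [Real.norm_eq_abs, Real.norm_eq_abs, abs_of_nonneg (sq_nonneg (h r))] at hr
  exact hr.trans (mul_le_mul_of_nonneg_right (le_abs_self C) (sq_nonneg _))

/-- Chain rule at a point where the curve is differentiable and its vertical deviation, measured
in the group from that point, is of second order. -/
lemma Gamma1.hasDerivAt_comp {F : ℝ × ℝ × ℝ → ℝ} (hF : Gamma1 F) {x : ℝ → ℝ × ℝ × ℝ}
    {v : ℝ × ℝ × ℝ} {s : ℝ} (hx : HasDerivAt x v s)
    (hA : (fun r => (x r).2.2 - (x s).2.2 -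
      ((x s).1 * ((x r).2.1 - (x s).2.1) - (x s).2.1 * ((x r).1 - (x s).1)) / 2)
        =O[𝓝 s] fun r => (r - s) ^ 2) :
    HasDerivAt (fun r => F (x r)) (v.1 * X1d F (x s) + v.2.1 * X2d F (x s)) s := by
  set p := x s with hp
  have h1 : HasDerivAt (fun r => (x r).1) v.1 s := hx.fst
  have h2 : HasDerivAt (fun r => (x r).2.1) v.2.1 s := hx.snd.fst
  set a : ℝ → ℝ := fun r => (x r).1 - p.1 with ha
  set b : ℝ → ℝ := fun r => (x r).2.1 - p.2.1 with hb
  have haO : a =O[𝓝 s] fun r => r - s := h1.isBigO_sub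
  have hbO : b =O[𝓝 s] fun r => r - s := h2.isBigO_sub
  set c : ℝ → ℝ := fun r => (x r).2.2 - p.2.2 - (p.1 * b r - p.2.1 * a r) / 2 - a r * b r / 2 with hc
  have hcO : c =O[𝓝 s] fun r => (r - s) ^ 2 := by
    have hab := (haO.mul hbO).const_mul_left (1 / 2)
    refine (hA.sub (hab.congr_right fun r => (sq (r - s)).symm)).congr_left fun r => ?_
    simp only [hc]; ring
  set u : ℝ → ℝ := fun r => √|c r| with hu
  set w : ℝ → ℝ := fun r => SignType.sign (c r) * √|c r| with hw
  have huw : ∀ r, u r * w r = c r := fun r => by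
    have := Real.mul_self_sqrt (abs_nonneg (c r))
    simp only [hu, hw]
    rw [mul_left_comm, this, sign_mul_abs]
  have huO : u =O[𝓝 s] fun r => r - s := isBigO_sqrt_abs hcO
  have hwO : w =O[𝓝 s] fun r => r - s := by
    refine IsBigO.trans (IsBigO.of_norm_le fun r => ?_) huO
    rcases lt_trichotomy (c r) 0 with h | h | h <;>
      simp [hu, hw, h, abs_of_nonneg (Real.sqrt_nonneg _)]
  have hs0 : Tendsto (fun r : ℝ => r - s) (𝓝 s) (𝓝 0) := by
    simpa using (continuous_sub_right s).tendsto s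
  have ha0 := haO.trans_tendsto hs0
  have hb0 := hbO.trans_tendsto hs0
  have hu0 := huO.trans_tendsto hs0
  have hw0 := hwO.trans_tendsto hs0
  have hu0' : Tendsto (fun r => -u r) (𝓝 s) (𝓝 0) := by simpa using hu0.neg
  have hw0' : Tendsto (fun r => -w r) (𝓝 s) (𝓝 0) := by simpa using hw0.neg
  have t0 : Tendsto (fun _ : ℝ => p) (𝓝 s) (𝓝 p) := tendsto_const_nhds
  have t1 := tendsto_flow continuous_flowX1 flowX1_zero t0 ha0
  have t2 := tendsto_flow continuous_flowX2 flowX2_zero t1 hb0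
  have t3 := tendsto_flow continuous_flowX1 flowX1_zero t2 hu0
  have t4 := tendsto_flow continuous_flowX2 flowX2_zero t3 hw0
  have t5 := tendsto_flow continuous_flowX1 flowX1_zero t4 hu0'
  have e1 := (isLittleO_flow continuous_flowX1 flowX1_zero hF.2.1 hF.hasDerivAt_flowX1
    t0 ha0).trans_isBigO haO
  have e2 := (isLittleO_flow continuous_flowX2 flowX2_zero hF.2.2 hF.hasDerivAt_flowX2
    t1 hb0).trans_isBigO hbO
  have e3 := (isLittleO_flow continuous_flowX1 flowX1_zero hF.2.1 hF.hasDerivAt_flowX1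
    t2 hu0).trans_isBigO huO
  have e4 := (isLittleO_flow continuous_flowX2 flowX2_zero hF.2.2 hF.hasDerivAt_flowX2
    t3 hw0).trans_isBigO hwO
  have e5 := (isLittleO_flow continuous_flowX1 flowX1_zero hF.2.1 hF.hasDerivAt_flowX1
    t4 hu0').trans_isBigO huO.neg_left
  have e6 := (isLittleO_flow continuous_flowX2 flowX2_zero hF.2.2 hF.hasDerivAt_flowX2
    t5 hw0').trans_isBigO hwO.neg_left
  have d1 := ((hasDerivAt_iff_isLittleO.1 h1).const_mul_left (X1d F p))
  have d2 := ((hasDerivAt_iff_isLittleO.1 h2).const_mul_left (X2d F p))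
  rw [hasDerivAt_iff_isLittleO]
  refine ((((((((e1.add e2).add e3).add e4).add e5).add e6).add d1).add d2)).congr_left fun r => ?_
  have hend : flowX2 (flowX1 (flowX2 (flowX1 (flowX2 (flowX1 p (a r)) (b r)) (u r)) (w r)) (-u r))
      (-w r) = x r := by
    rw [flow_commutator, huw]
    refine Prod.ext ?_ (Prod.ext ?_ ?_) <;> simp only [ha, hb, hc] <;> ring
  rw [hend]
  simp only [smul_eq_mul, ha, hb]
  ring

/-- At a point where the curve is differentiable and the integral of `|z₁| + |z₂|` is too, the
vertical deviation of a horizontal curve is of second order. -/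
lemma IsHorizontalCurveOn.isBigO_vertical {T t s : ℝ} {z : ℝ → ℝ × ℝ} {ξ v : ℝ × ℝ × ℝ}
    {x : ℝ → ℝ × ℝ × ℝ} (hx : IsHorizontalCurveOn 0 T z ξ x) (hs : 0 < s) (hst : s < t)
    (htT : t ≤ T) (hI : IntervalIntegrable (fun r => fH (x r) (z r)) volume 0 t)
    {m : ℝ} (hm : HasDerivAt (fun r => ∫ y in 0..r, |(z y).1| + |(z y).2|) m s)
    (hxs : HasDerivAt x v s) :
    (fun r => (x r).2.2 - (x s).2.2 -
      ((x s).1 * ((x r).2.1 - (x s).2.1) - (x s).2.1 * ((x r).1 - (x s).1)) / 2)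
        =O[𝓝 s] fun r => (r - s) ^ 2 := by
  obtain ⟨C, hC0, hC⟩ := hxs.isBigO_sub.exists_pos
  obtain ⟨δ, hδ, hball⟩ := Metric.eventually_nhds_iff_ball.1 hC.bound
  obtain ⟨K, hK⟩ := hm.isBigO_sub.bound
  refine IsBigO.of_bound (C * K) ?_
  filter_upwards [hK, Metric.ball_mem_nhds s hδ, Ioo_mem_nhds hs hst] with r hKr hrδ hr
  have hsub : ∀ {y}, y ∈ Icc 0 t → IntervalIntegrable (fun r => fH (x r) (z r)) volume 0 y :=
    fun {y} hy => hI.mono_set (by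
      rw [uIcc_of_le hy.1, uIcc_of_le (hs.trans hst).le]; exact Icc_subset_Icc_right hy.2)
  have hIs := hsub (y := s) ⟨hs.le, hst.le⟩
  have hIr := hsub (y := r) ⟨hr.1.le, hr.2.le⟩
  have hJ : IntervalIntegrable (fun r => fH (x r) (z r)) volume s r := hIs.symm.trans hIr
  have hdiff : x r - x s = ∫ y in s..r, fH (x y) (z y) := by
    rw [hx r ⟨hr.1.le, hr.2.le.trans htT⟩, hx s ⟨hs.le, hst.le.trans htT⟩,
      add_sub_add_left_eq_sub, intervalIntegral.integral_interval_sub_left hIr hIs]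
  have comp : ∀ {α β : ℝ}, IntervalIntegrable (fun r => fH (x r) (z r)) volume α β →
      IntervalIntegrable (fun r => (z r).1) volume α β ∧
      IntervalIntegrable (fun r => (z r).2) volume α β ∧
      IntervalIntegrable (fun r => ((z r).2 * (x r).1 - (z r).1 * (x r).2.1) / 2) volume α β :=
    fun h => ⟨⟨h.1.fst, h.2.fst⟩, ⟨h.1.snd.fst, h.2.snd.fst⟩, ⟨h.1.snd.snd, h.2.snd.snd⟩⟩
  obtain ⟨j1, j2, j3⟩ := comp hJ
  have k1 : (x r).1 - (x s).1 = ∫ y in s..r, (z y).1 := by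
    have := (ContinuousLinearMap.fst ℝ ℝ (ℝ × ℝ)).intervalIntegral_comp_comm hJ
    rw [← hdiff] at this
    simpa [fH] using this.symm
  have k2 : (x r).2.1 - (x s).2.1 = ∫ y in s..r, (z y).2 := by
    have := ((ContinuousLinearMap.fst ℝ ℝ ℝ).comp
      (ContinuousLinearMap.snd ℝ ℝ (ℝ × ℝ))).intervalIntegral_comp_comm hJ
    rw [← hdiff] at this
    simpa [fH] using this.symm
  have k3 : (x r).2.2 - (x s).2.2 =
      ∫ y in s..r, ((z y).2 * (x y).1 - (z y).1 * (x y).2.1) / 2 := by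
    have := ((ContinuousLinearMap.snd ℝ ℝ ℝ).comp
      (ContinuousLinearMap.snd ℝ ℝ (ℝ × ℝ))).intervalIntegral_comp_comm hJ
    rw [← hdiff] at this
    simpa [fH] using this.symm
  have hA : (x r).2.2 - (x s).2.2 -
      ((x s).1 * ((x r).2.1 - (x s).2.1) - (x s).2.1 * ((x r).1 - (x s).1)) / 2 =
      ∫ y in s..r, ((z y).2 * ((x y).1 - (x s).1) - (z y).1 * ((x y).2.1 - (x s).2.1)) / 2 := by
    rw [k1, k2, k3, ← intervalIntegral.integral_const_mul, ← intervalIntegral.integral_const_mul,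
      ← intervalIntegral.integral_sub (j2.const_mul _) (j1.const_mul _),
      ← intervalIntegral.integral_div,
      ← intervalIntegral.integral_sub j3 (((j2.const_mul _).sub (j1.const_mul _)).div_const _)]
    congr 1; ext y; ring
  rw [hA]
  have jn : IntervalIntegrable (fun y => |(z y).1| + |(z y).2|) volume s r := j1.abs.add j2.abs
  have bound : ‖∫ y in s..r,
      ((z y).2 * ((x y).1 - (x s).1) - (z y).1 * ((x y).2.1 - (x s).2.1)) / 2‖ ≤
      |∫ y in s..r, C * |r - s| * (|(z y).1| + |(z y).2|)| := by
    refine intervalIntegral.norm_integral_le_abs_of_norm_le ?_ (jn.const_mul _)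
    refine (ae_restrict_mem measurableSet_uIoc).mono fun y hy => ?_
    have hys : |y - s| ≤ |r - s| := by
      rcases le_total s r with h | h
      · rw [uIoc_of_le h] at hy
        rw [abs_of_pos (by linarith [hy.1]), abs_of_nonneg (by linarith)]; linarith [hy.2]
      · rw [uIoc_of_ge h] at hy
        rw [abs_of_nonpos (by linarith [hy.2]), abs_of_nonpos (by linarith)]; linarith [hy.1]
    have hyb : y ∈ Metric.ball s δ := by
      rw [Metric.mem_ball, Real.dist_eq] at hrδ ⊢; exact hys.trans_lt hrδ
    have hxy := hball y hyb
    have hn : ‖x y - x s‖ ≤ C * |r - s| :=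
      hxy.trans (mul_le_mul_of_nonneg_left hys hC0.le)
    have n1 : |(x y).1 - (x s).1| ≤ C * |r - s| := (norm_fst_le (x y - x s)).trans hn
    have n2 : |(x y).2.1 - (x s).2.1| ≤ C * |r - s| :=
      ((norm_fst_le (x y - x s).2).trans (norm_snd_le (x y - x s))).trans hn
    rw [Real.norm_eq_abs, abs_div, abs_two]
    have h1 := abs_sub ((z y).2 * ((x y).1 - (x s).1)) ((z y).1 * ((x y).2.1 - (x s).2.1))
    rw [abs_mul, abs_mul] at h1
    have h2 := mul_le_mul_of_nonneg_left n1 (abs_nonneg (z y).2)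
    have h3 := mul_le_mul_of_nonneg_left n2 (abs_nonneg (z y).1)
    have h4 : 0 ≤ C * |r - s| * (|(z y).1| + |(z y).2|) := by positivity
    linarith
  refine bound.trans ?_
  obtain ⟨i1, i2, -⟩ := comp hIs
  obtain ⟨i1', i2', -⟩ := comp hIr
  rw [intervalIntegral.integral_interval_sub_left (i1'.abs.add i2'.abs) (i1.abs.add i2.abs)] at hKr
  rw [intervalIntegral.integral_const_mul, abs_mul, abs_of_nonneg (by positivity : 0 ≤ C * |r - s|),
    norm_pow, sq]
  simp only [Real.norm_eq_abs] at hKr ⊢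
  calc _ ≤ C * |r - s| * (K * |r - s|) := mul_le_mul_of_nonneg_left hKr (by positivity)
    _ = _ := by ring

/-- if `F ∈ Γ¹(ℍ)` and `x` is a horizontal curve with (a.e.) horizontal
velocity `z = (ẋ₁, ẋ₂)`, then for a.e. `s ∈ (0,T)` the map `s ↦ F(x(s))` is
differentiable with derivative `(ẋ₁(s), ẋ₂(s)) · ∇_H F(x(s))`. -/
theorem stmt_5 (T : ℝ) (hT : 0 < T)
    (F : ℝ × ℝ × ℝ → ℝ) (hF : Gamma1 F)
    (x : ℝ → ℝ × ℝ × ℝ) (z : ℝ → ℝ × ℝ) (hzm : Measurable z)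
    (hx : IsHorizontalCurveOn 0 T z (x 0) x)
    (hx' : ∀ᵐ s ∂(volume.restrict (Set.Ioo 0 T)), HasDerivAt x (fH (x s) (z s)) s) :
    ∀ᵐ s ∂(volume.restrict (Set.Ioo 0 T)),
      HasDerivAt (fun r : ℝ => F (x r))
        ((z s).1 * X1d F (x s) + (z s).2 * X2d F (x s)) s := by
  let I : ℝ → Prop := fun t => IntervalIntegrable (fun r => fH (x r) (z r)) volume 0 t
  have hmono : ∀ {t t' : ℝ}, 0 ≤ t → t ≤ t' → I t' → I t := fun h0 h h' =>
    h'.mono_set (by rw [uIcc_of_le h0, uIcc_of_le (h0.trans h)]; exact Icc_subset_Icc_right h)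
  have hleb : ∀ᵐ s, ∀ t : ℚ, I t → s ∈ Ioo (0 : ℝ) t →
      HasDerivAt (fun r => ∫ y in 0..r, |(z y).1| + |(z y).2|) (|(z s).1| + |(z s).2|) s := by
    rw [ae_all_iff]
    intro t
    by_cases ht : I t
    · have h1 : IntervalIntegrable (fun y => (z y).1) volume 0 t := ⟨ht.1.fst, ht.2.fst⟩
      have h2 : IntervalIntegrable (fun y => (z y).2) volume 0 t := ⟨ht.1.snd.fst, ht.2.snd.fst⟩
      filter_upwards [(h1.abs.add h2.abs).ae_hasDerivAt_integral] with s hs _ hst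
      refine hs ?_ 0 left_mem_uIcc
      rw [uIcc_of_le (hst.1.trans hst.2).le]
      exact Ioo_subset_Icc_self hst
    · exact Eventually.of_forall fun s h => absurd h ht
  have hcrit : ∀ᵐ s : ℝ, ¬(0 < s ∧ (∀ t, s < t → ¬I t) ∧ ∀ t, 0 < t → t < s → I t) := by
    rw [ae_iff]
    refine Set.Subsingleton.measure_zero ?_ _
    intro s hs s' hs'
    simp only [mem_ofPred_eq, not_not] at hs hs'
    by_contra hne
    wlog h : s < s' generalizing s s'
    · exact this hs' hs (Ne.symm hne) (lt_of_le_of_ne (not_lt.1 h) (Ne.symm hne))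
    obtain ⟨t, ht, ht'⟩ := exists_between h
    exact hs.2.1 t ht (hs'.2.2 t (hs.1.trans ht) ht')
  filter_upwards [hx', ae_restrict_of_ae hleb, ae_restrict_of_ae hcrit,
    ae_restrict_mem measurableSet_Ioo] with s hds hls hcs hs
  refine hF.hasDerivAt_comp hds ?_
  by_cases hup : ∃ t, s < t ∧ I t
  · obtain ⟨t, hst, ht⟩ := hup
    obtain ⟨q, hq, hq'⟩ := exists_rat_btwn (lt_min hst hs.2)
    have hIq : I q := hmono (hs.1.trans hq).le (hq'.le.trans (min_le_left _ _)) ht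
    exact hx.isBigO_vertical hs.1 hq (hq'.le.trans (min_le_right _ _)) hIq
      (hls q hIq ⟨hs.1, hq⟩) hds
  · push Not at hup
    have hlow : ∃ t, 0 < t ∧ t < s ∧ ¬I t := by
      by_contra! hcon
      exact hcs ⟨hs.1, hup, hcon⟩
    obtain ⟨t, ht0, hts, ht⟩ := hlow
    have hconst : ∀ r ∈ Ioo t T, x r = x 0 := fun r hr => by
      rw [hx r ⟨(ht0.trans hr.1).le, hr.2.le⟩, intervalIntegral.integral_undef
        fun h => ht (hmono ht0.le hr.1.le h), add_zero]
    refine (isBigO_zero _ _).congr' ?_ EventuallyEq.rfl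
    filter_upwards [Ioo_mem_nhds hts hs.2] with r hr
    simp [hconst r hr, hconst s ⟨hts, hs.2⟩]
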